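/- Let X be a C_b^∞-vector field on ℝ^d, let ψ ∈ C_b^∞(ℝ^d;ℝ), and let γ ∈ (0,1]. Then ψX is again a C_b^∞-vector field and there exists c > 0 such that ‖φ‖_{2;ψX,γ} ≤ c ‖φ‖_{2;X,γ} for all φ ∈ C_c^∞(ℝ^d). -/

import Mathlib

open MeasureTheory Complex Real Finset

noncomputable section

/-- Euclidean space `ℝ^d`. -/
abbrev Ec (d : ℕ) := EuclideanSpace ℝ (Fin d)

variable {d : ℕ}

/-- The `L²` norm of a complex-valued function. -/
def l2norm (f : Ec d → ℂ) : ℝ := (∫ x, ‖f x‖ ^ 2).sqrt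

/-- Smooth compactly supported test functions. -/
def IsCc (φ : Ec d → ℂ) : Prop := ContDiff ℝ (⊤ : ℕ∞) φ ∧ HasCompactSupport φ

/-- A `C_b^∞`-vector field on `ℝ^d`: a smooth coefficient map `a : ℝ^d → ℝ^d` which is
bounded together with all its derivatives. -/
def IsCbVF (a : Ec d → Ec d) : Prop :=
  ContDiff ℝ (⊤ : ℕ∞) a ∧ ∀ n : ℕ, ∃ C : ℝ, ∀ x, ‖iteratedFDeriv ℝ n a x‖ ≤ C

/-- `f` is the (smooth, globally defined) flow `f t x = exp(tX)(x)` of the vector field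
with coefficient map `a`:  `f 0 x = x` and `∂_t f t x = a (f t x)`. -/
def IsFlowOf (a : Ec d → Ec d) (f : ℝ → Ec d → Ec d) : Prop :=
  ContDiff ℝ (⊤ : ℕ∞) (fun p : ℝ × Ec d => f p.1 p.2) ∧
    (∀ x, f 0 x = x) ∧
    ∀ t x, HasDerivAt (fun s => f s x) (a (f t x)) t

/-- The Hölder norm `‖φ‖_{2;X,γ} = ‖φ‖₂ + sup_{0<|t|≤1} |t|^{-γ} ‖e^{tX}φ - φ‖₂`
associated with the flow `f` of a vector field `X`. -/
def vfHolder (f : ℝ → Ec d → Ec d) (γ : ℝ) (φ : Ec d → ℂ) : ℝ :=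
  l2norm φ +
    sSup ((fun t : ℝ => |t| ^ (-γ) * l2norm fun x => φ (f t x) - φ x) ''
      {t : ℝ | 0 < |t| ∧ |t| ≤ 1})

/-- The universal Hölder norm
`‖φ‖_{2;γ} = ‖φ‖₂ + sup_{0<|z|≤1} |z|^{-γ} ‖φ(· - z) - φ‖₂`. -/
def uHolder (γ : ℝ) (φ : Ec d → ℂ) : ℝ :=
  l2norm φ +
    sSup ((fun z : Ec d => ‖z‖ ^ (-γ) * l2norm fun x => φ (x - z) - φ x) ''
      {z : Ec d | 0 < ‖z‖ ∧ ‖z‖ ≤ 1})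

/-- A smooth real-valued function which is bounded together with all its derivatives. -/
def IsCbR (ψ : Ec d → ℝ) : Prop :=
  ContDiff ℝ (⊤ : ℕ∞) ψ ∧ ∀ n : ℕ, ∃ C : ℝ, ∀ x, ‖iteratedFDeriv ℝ n ψ x‖ ≤ C

lemma IsCbVF.smul {a : Ec d → Ec d} {ψ : Ec d → ℝ} (ha : IsCbVF a) (hψ : IsCbR ψ) :
    IsCbVF (fun x => ψ x • a x) := by
  refine ⟨hψ.1.smul ha.1, fun n => ?_⟩
  choose A hA using ha.2
  choose P hP using hψ.2
  refine ⟨∑ i ∈ Finset.range (n + 1), (n.choose i : ℝ) * P i * A (n - i), fun x => ?_⟩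
  refine (norm_iteratedFDeriv_smul_le (N := n) (hψ.1.of_le (by exact_mod_cast le_top))
    (ha.1.of_le (by exact_mod_cast le_top)) x le_rfl).trans (Finset.sum_le_sum fun i _ => ?_)
  have hPi : 0 ≤ P i := (norm_nonneg _).trans (hP i x)
  gcongr
  exacts [hP i x, hA _ x]

lemma exists_lipschitzWith_of_iteratedFDeriv_bound {F : Type*} [NormedAddCommGroup F]
    [NormedSpace ℝ F] {a : Ec d → F} (ha : ContDiff ℝ (⊤ : ℕ∞) a)
    (hb : ∃ C : ℝ, ∀ x, ‖iteratedFDeriv ℝ 1 a x‖ ≤ C) : ∃ K, LipschitzWith K a := by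
  obtain ⟨C, hC⟩ := hb
  refine ⟨C.toNNReal, lipschitzWith_of_nnnorm_fderiv_le
    (ha.differentiable (by simp)) fun x => ?_⟩
  rw [← norm_toNNReal]
  exact Real.toNNReal_le_toNNReal (norm_iteratedFDeriv_one (𝕜 := ℝ) a ▸ hC x)

lemma exists_norm_le_of_iteratedFDeriv_bound {F : Type*} [NormedAddCommGroup F]
    [NormedSpace ℝ F] {a : Ec d → F}
    (hb : ∃ C : ℝ, ∀ x, ‖iteratedFDeriv ℝ 0 a x‖ ≤ C) : ∃ M : NNReal, ∀ x, ‖a x‖ ≤ M := by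
  obtain ⟨C, hC⟩ := hb
  exact ⟨C.toNNReal, fun x => (norm_iteratedFDeriv_zero (𝕜 := ℝ) (f := a) ▸ hC x).trans
    (Real.le_coe_toNNReal C)⟩

namespace IsFlowOf

variable {a : Ec d → Ec d} {f : ℝ → Ec d → Ec d} {K : NNReal}

lemma eq_of_hasDerivAt (hf : IsFlowOf a f) (hK : LipschitzWith K a) {y : ℝ → Ec d}
    (hy : ∀ s, HasDerivAt y (a (y s)) s) (t : ℝ) : y t = f t (y 0) := by
  have := ODE_solution_unique_univ (v := fun _ => a) (s := fun _ => Set.univ) (K := K)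
    (f := y) (g := fun t => f t (y 0)) (t₀ := 0) (fun _ => hK.lipschitzOnWith)
    (fun t => ⟨hy t, trivial⟩) (fun t => ⟨hf.2.2 t _, trivial⟩) (hf.2.1 _).symm
  exact congrFun this t

lemma apply_add (hf : IsFlowOf a f) (hK : LipschitzWith K a) (s t : ℝ) (x : Ec d) :
    f (s + t) x = f s (f t x) := by
  have := hf.eq_of_hasDerivAt hK (y := fun s => f (s + t) x)
    (fun s => (hf.2.2 (s + t) x).comp_add_const s t) s
  simpa using this

lemma neg (hf : IsFlowOf a f) : IsFlowOf (fun x => -a x) (fun t => f (-t)) := by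
  refine ⟨?_, fun x => by simpa using hf.2.1 x, fun t x => ?_⟩
  · exact hf.1.comp (contDiff_fst.neg.prodMk contDiff_snd)
  · have := (hf.2.2 (-t) x).scomp t (hasDerivAt_neg t)
    rwa [neg_one_smul] at this

lemma dist_le (hf : IsFlowOf a f) (hK : LipschitzWith K a) (t : ℝ) (x y : Ec d) :
    dist (f t x) (f t y) ≤ dist x y * Real.exp (K * |t|) := by
  wlog ht : 0 ≤ t generalizing a f t
  · have := this hf.neg hK.neg (-t) (by linarith)
    simpa using this
  have := dist_le_of_trajectories_ODE (v := fun _ => a) (K := K)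
    (f := fun t => f t x) (g := fun t => f t y) (a := 0) (b := t) (fun _ => hK)
    (fun s _ => (hf.2.2 s x).continuousAt.continuousWithinAt)
    (fun s _ => (hf.2.2 s x).hasDerivWithinAt)
    (fun s _ => (hf.2.2 s y).continuousAt.continuousWithinAt)
    (fun s _ => (hf.2.2 s y).hasDerivWithinAt) (δ := dist x y)
    (by simp [hf.2.1]) t (Set.right_mem_Icc.2 ht)
  simpa [abs_of_nonneg ht] using this

lemma lipschitzWith_time (hf : IsFlowOf a f) {M : NNReal} (hM : ∀ x, ‖a x‖ ≤ M) (x : Ec d) :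
    LipschitzWith M (fun t => f t x) :=
  lipschitzWith_of_nnnorm_deriv_le (fun t => (hf.2.2 t x).differentiableAt) fun t => by
    rw [(hf.2.2 t x).deriv]
    exact hM _

lemma continuous_uncurry (hf : IsFlowOf a f) : Continuous fun p : ℝ × Ec d => f p.1 p.2 :=
  hf.1.continuous

lemma continuous_apply (hf : IsFlowOf a f) (t : ℝ) : Continuous (f t) :=
  hf.continuous_uncurry.comp (by fun_prop : Continuous fun x : Ec d => (t, x))

/-- The flow of `ψ X` is a time change of the flow of `X`. -/
lemma exists_smul_eq (hf : IsFlowOf a f) {M M' L K' : NNReal} (hM : ∀ x, ‖a x‖ ≤ M)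
    {ψ : Ec d → ℝ} (hL : LipschitzWith L ψ) (hM' : ∀ x, ‖ψ x‖ ≤ M')
    {g : ℝ → Ec d → Ec d} (hg : IsFlowOf (fun x => ψ x • a x) g)
    (hK' : LipschitzWith K' (fun x => ψ x • a x)) {t : ℝ} (ht : |t| ≤ 1) (x : Ec d) :
    ∃ τ : ℝ, |τ| ≤ M' * |t| ∧ g t x = f τ x := by
  have h0 : (0 : ℝ) ∈ Set.Icc (-1 : ℝ) 1 := by simp
  have htm : t ∈ Set.Icc (-1 : ℝ) 1 := abs_le.1 ht
  have hP : IsPicardLindelof (fun _ s => ψ (f s x)) (⟨0, h0⟩ : Set.Icc (-1 : ℝ) 1) (0 : ℝ)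
      M' 0 M' (L * M) :=
    .of_time_independent (fun s _ => hM' _)
      ((hL.comp (hf.lipschitzWith_time hM x)).lipschitzOnWith) (by simp)
  obtain ⟨α, hα0, hα⟩ := hP.exists_eq_forall_mem_Icc_hasDerivWithinAt₀
  simp only at hα0
  refine ⟨α t, ?_, ?_⟩
  · have := (convex_Icc (-1 : ℝ) 1).norm_image_sub_le_of_norm_hasDerivWithin_le hα
      (fun s _ => hM' _) h0 htm
    simpa [hα0] using this
  · have := ODE_solution_unique_of_mem_Icc (v := fun _ y => ψ y • a y) (K := K')
      (s := fun _ => Set.univ) (f := fun t => g t x) (g := fun t => f (α t) x)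
      (a := -1) (b := 1) (t₀ := 0) (fun _ _ => hK'.lipschitzOnWith) (by simp)
      (fun s _ => (hg.2.2 s x).continuousAt.continuousWithinAt)
      (fun s _ => hg.2.2 s x) (fun _ _ => trivial)
      (fun s hs => (hf.2.2 (α s) x).continuousAt.comp_continuousWithinAt
        (hα s hs).continuousWithinAt)
      (fun s hs => (hf.2.2 (α s) x).scomp s
        ((hα s (Set.Ioo_subset_Icc_self hs)).hasDerivAt (Icc_mem_nhds hs.1 hs.2)))
      (fun _ _ => trivial) (by simp [hα0, hf.2.1, hg.2.1])
    exact this htm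

end IsFlowOf

lemma exists_volume_image_le_of_lipschitzWith (L : NNReal) :
    ∃ C : NNReal, ∀ h : Ec d → Ec d, LipschitzWith L h →
      ∀ s : Set (Ec d), volume (h '' s) ≤ C * volume s := by
  refine ⟨L ^ d, fun h hh s => ?_⟩
  obtain ⟨c, hc⟩ : ∃ c : NNReal, (volume : Measure (Ec d)) =
      c • Measure.hausdorffMeasure (Module.finrank ℝ (Ec d)) :=
    ⟨_, Measure.isAddLeftInvariant_eq_smul _ _⟩
  rw [hc]
  simp only [Measure.smul_apply, ENNReal.smul_def, smul_eq_mul]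
  have := hh.hausdorffMeasure_image_le (d := Module.finrank ℝ (Ec d)) (by positivity) s
  calc _ ≤ _ := mul_le_mul_right this c
    _ = _ := by simp; ring

/-- Flows of Lipschitz vector fields are quasi-measure-preserving, uniformly on bounded times. -/
lemma IsFlowOf.exists_lintegral_comp_le {a : Ec d → Ec d} {f : ℝ → Ec d → Ec d} {K : NNReal}
    (hf : IsFlowOf a f) (hK : LipschitzWith K a) (T : ℝ) :
    ∃ C : NNReal, ∀ t : ℝ, |t| ≤ T → ∀ h : Ec d → ENNReal, Measurable h →
      ∫⁻ x, h (f t x) ≤ C * ∫⁻ x, h x := by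
  obtain ⟨C, hC⟩ := exists_volume_image_le_of_lipschitzWith (d := d)
    (Real.exp (K * T)).toNNReal
  refine ⟨C, fun t ht h hh => ?_⟩
  have hm : Measurable (f t) := (hf.continuous_apply t).measurable
  have hlip : LipschitzWith (Real.exp (K * T)).toNNReal (f (-t)) := by
    refine LipschitzWith.of_dist_le_mul fun x y => (hf.dist_le hK (-t) x y).trans ?_
    rw [Real.coe_toNNReal _ (Real.exp_pos _).le, mul_comm, abs_neg]
    gcongr
  have hmap : Measure.map (f t) volume ≤ (C : ENNReal) • volume := by
    refine Measure.le_iff.2 fun s hs => ?_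
    rw [Measure.map_apply hm hs]
    refine (measure_mono ?_).trans (hC _ hlip s)
    intro x hx
    refine ⟨f t x, hx, ?_⟩
    rw [← hf.apply_add hK, neg_add_cancel, hf.2.1]
  rw [← lintegral_map hh hm]
  refine (lintegral_mono' hmap le_rfl).trans ?_
  rw [lintegral_smul_measure, smul_eq_mul]

lemma l2norm_nonneg (h : Ec d → ℂ) : 0 ≤ l2norm h := Real.sqrt_nonneg _

lemma l2norm_sq_eq_toReal {h : Ec d → ℂ} (hh : Continuous h) :
    l2norm h ^ 2 = (∫⁻ x, ‖h x‖ₑ ^ 2).toReal := by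
  rw [l2norm, Real.sq_sqrt (integral_nonneg fun x => by positivity),
    integral_eq_lintegral_of_nonneg_ae (.of_forall fun x => by positivity)
      (by fun_prop : Continuous fun x => ‖h x‖ ^ 2).aestronglyMeasurable]
  congr 1
  refine lintegral_congr fun x => ?_
  rw [ENNReal.ofReal_pow (norm_nonneg _), ofReal_norm]

lemma lintegral_enorm_sq_eq_ofReal {h : Ec d → ℂ} (hh : Continuous h)
    (hfin : ∫⁻ x, ‖h x‖ₑ ^ 2 ≠ ⊤) : ∫⁻ x, ‖h x‖ₑ ^ 2 = ENNReal.ofReal (l2norm h ^ 2) := by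
  rw [l2norm_sq_eq_toReal hh, ENNReal.ofReal_toReal hfin]

lemma l2norm_le_of_lintegral_le {h : Ec d → ℂ} (hh : Continuous h) {B : ℝ} (hB : 0 ≤ B)
    (hle : ∫⁻ x, ‖h x‖ₑ ^ 2 ≤ ENNReal.ofReal (B ^ 2)) : l2norm h ≤ B := by
  refine le_of_sq_le_sq ?_ hB
  rw [l2norm_sq_eq_toReal hh]
  exact ENNReal.toReal_le_of_le_ofReal (by positivity) hle

lemma enorm_sub_sq_le {E : Type*} [NormedAddCommGroup E] (u v w : E) :
    ‖u - w‖ₑ ^ 2 ≤ 2 * (‖u - v‖ₑ ^ 2 + ‖v - w‖ₑ ^ 2) := by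
  have h1 : ‖u - w‖ₑ ≤ ‖u - v‖ₑ + ‖v - w‖ₑ := by
    simpa using enorm_add_le (u - v) (v - w)
  have h2 := ENNReal.rpow_add_le_mul_rpow_add_rpow ‖u - v‖ₑ ‖v - w‖ₑ (p := 2) (by norm_num)
  norm_num at h2
  exact (pow_le_pow_left' h1 2).trans h2

lemma IsCc.lintegral_enorm_sq_lt_top {φ : Ec d → ℂ} (hφ : IsCc φ) : ∫⁻ x, ‖φ x‖ₑ ^ 2 < ⊤ := by
  have h := (hφ.1.continuous.memLp_of_hasCompactSupport hφ.2 (p := 2) (μ := volume))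
  have := h.2
  rw [eLpNorm_lt_top_iff_lintegral_rpow_enorm_lt_top (by norm_num) (by norm_num)] at this
  simpa using this

lemma IsFlowOf.continuous_comp_sub {a : Ec d → Ec d} {f : ℝ → Ec d → Ec d} (hf : IsFlowOf a f)
    {φ : Ec d → ℂ} (hφ : Continuous φ) (t : ℝ) : Continuous fun x => φ (f t x) - φ x :=
  (hφ.comp (hf.continuous_apply t)).sub hφ

lemma IsFlowOf.bddAbove_vfHolder {a : Ec d → Ec d} {f : ℝ → Ec d → Ec d} (hf : IsFlowOf a f)
    {M : NNReal} (hM : ∀ x, ‖a x‖ ≤ M) {γ : ℝ} (hγ1 : γ ≤ 1) {φ : Ec d → ℂ} (hφ : IsCc φ) :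
    BddAbove ((fun t : ℝ => |t| ^ (-γ) * l2norm fun x => φ (f t x) - φ x) ''
      {t : ℝ | 0 < |t| ∧ |t| ≤ 1}) := by
  obtain ⟨L, hL⟩ := hφ.1.lipschitzWith_of_hasCompactSupport hφ.2 (by simp)
  have hS : IsCompact (Metric.cthickening M (tsupport φ)) := IsCompact.cthickening hφ.2
  set S := Metric.cthickening M (tsupport φ)
  have hmove : ∀ t x, dist (f t x) x ≤ M * |t| := fun t x => by
    simpa [hf.2.1] using (hf.lipschitzWith_time hM x).dist_le_mul t 0
  refine ⟨L * M * √(volume.real S), ?_⟩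
  rintro _ ⟨t, ⟨ht0, ht1⟩, rfl⟩
  have hpt : ∀ x, ‖φ (f t x) - φ x‖ ≤ L * M * |t| := fun x => by
    rw [← dist_eq_norm, mul_assoc]
    exact (hL.dist_le_mul _ _).trans (mul_le_mul_of_nonneg_left (hmove t x) L.coe_nonneg)
  have hzero : ∀ x, x ∉ S → φ (f t x) - φ x = 0 := fun x hx => by
    have h1 : x ∉ tsupport φ := fun h => hx (Metric.self_subset_cthickening _ h)
    have h2 : f t x ∉ tsupport φ := fun h => hx
      (Metric.mem_cthickening_of_dist_le x _ _ _ h (by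
        rw [dist_comm]
        exact (hmove t x).trans (mul_le_of_le_one_right M.coe_nonneg ht1)))
    rw [image_eq_zero_of_notMem_tsupport h1, image_eq_zero_of_notMem_tsupport h2, sub_zero]
  have hl2 : (l2norm fun x => φ (f t x) - φ x) ≤ L * M * |t| * √(volume.real S) := by
    have : ∫ x, ‖φ (f t x) - φ x‖ ^ 2 ≤ ∫ x, S.indicator (fun _ => (L * M * |t| : ℝ) ^ 2) x := by
      refine integral_mono_of_nonneg (.of_forall fun x => by positivity)
        ((integrable_indicator_iff hS.measurableSet).2
          (integrableOn_const hS.measure_lt_top.ne)) (.of_forall fun x => ?_)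
      by_cases hx : x ∈ S
      · simp only [Set.indicator_of_mem hx]
        exact pow_le_pow_left₀ (norm_nonneg _) (hpt x) 2
      · simp [Set.indicator_of_notMem hx, hzero x hx]
    rw [integral_indicator_const _ hS.measurableSet, smul_eq_mul] at this
    refine (Real.sqrt_le_sqrt this).trans_eq ?_
    rw [mul_comm, Real.sqrt_mul (by positivity), Real.sqrt_sq (by positivity)]
  have ht : |t| ^ (-γ) * |t| ≤ 1 := by
    rw [← Real.rpow_add_one ht0.ne']
    exact Real.rpow_le_one ht0.le ht1 (by linarith)
  calc |t| ^ (-γ) * l2norm (fun x => φ (f t x) - φ x)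
      ≤ |t| ^ (-γ) * (L * M * |t| * √(volume.real S)) := by gcongr
    _ = (|t| ^ (-γ) * |t|) * (L * M * √(volume.real S)) := by ring
    _ ≤ 1 * (L * M * √(volume.real S)) := by gcongr
    _ = _ := one_mul _

lemma l2norm_le_vfHolder (f : ℝ → Ec d → Ec d) (γ : ℝ) (φ : Ec d → ℂ) :
    l2norm φ ≤ vfHolder f γ φ := by
  refine le_add_of_nonneg_right (Real.sSup_nonneg ?_)
  rintro _ ⟨t, -, rfl⟩
  exact mul_nonneg (by positivity) (l2norm_nonneg _)

/-- The `L²` modulus of continuity along the flow, on any bounded range of times. -/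
lemma IsFlowOf.exists_lintegral_comp_sub_le {a : Ec d → Ec d} {f : ℝ → Ec d → Ec d} {K M : NNReal}
    (hf : IsFlowOf a f) (hK : LipschitzWith K a) (hM : ∀ x, ‖a x‖ ≤ M) {γ : ℝ} (hγ0 : 0 < γ)
    (hγ1 : γ ≤ 1) (T : ℝ) :
    ∃ B : ℝ, 0 ≤ B ∧ ∀ φ : Ec d → ℂ, IsCc φ → ∀ s : ℝ, |s| ≤ T →
      ∫⁻ x, ‖φ (f s x) - φ x‖ₑ ^ 2 ≤ ENNReal.ofReal (B * (|s| ^ γ * vfHolder f γ φ) ^ 2) := by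
  obtain ⟨C, hC⟩ := hf.exists_lintegral_comp_le hK T
  refine ⟨2 * (C + 1), by positivity, fun φ hφ s hs => ?_⟩
  have hφfin := hφ.lintegral_enorm_sq_lt_top.ne
  have hN := l2norm_le_vfHolder f γ φ
  have hN0 := l2norm_nonneg φ
  have hcrude : ∫⁻ x, ‖φ (f s x) - φ x‖ₑ ^ 2 ≤
      ENNReal.ofReal (2 * (C + 1) * l2norm φ ^ 2) := by
    have hm : Measurable fun x => ‖φ x‖ₑ ^ 2 := by
      have := hφ.1.continuous
      fun_prop
    calc ∫⁻ x, ‖φ (f s x) - φ x‖ₑ ^ 2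
        ≤ ∫⁻ x, 2 * (‖φ (f s x)‖ₑ ^ 2 + ‖φ x‖ₑ ^ 2) := lintegral_mono fun x => by
          simpa using enorm_sub_sq_le (φ (f s x)) 0 (φ x)
      _ = 2 * ((∫⁻ x, ‖φ (f s x)‖ₑ ^ 2) + ∫⁻ x, ‖φ x‖ₑ ^ 2) := by
          rw [lintegral_const_mul' _ _ (by simp), lintegral_add_right _ hm]
      _ ≤ 2 * (C * (∫⁻ x, ‖φ x‖ₑ ^ 2) + ∫⁻ x, ‖φ x‖ₑ ^ 2) := by
          gcongr
          exact hC s hs _ hm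
      _ = ENNReal.ofReal (2 * (C + 1) * l2norm φ ^ 2) := by
          rw [lintegral_enorm_sq_eq_ofReal hφ.1.continuous hφfin,
            ENNReal.ofReal_mul (by positivity), ENNReal.ofReal_mul (by positivity),
            ENNReal.ofReal_add (by positivity) (by positivity)]
          simp
          ring
  rcases (abs_nonneg s).eq_or_lt with h0 | h0
  · have : s = 0 := abs_eq_zero.1 h0.symm
    simp [this, hf.2.1]
  rcases le_or_gt |s| 1 with h1 | h1
  · have hle : |s| ^ (-γ) * (l2norm fun x => φ (f s x) - φ x) ≤ vfHolder f γ φ :=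
      (le_csSup (hf.bddAbove_vfHolder hM hγ1 hφ) ⟨s, ⟨h0, h1⟩, rfl⟩).trans
        (le_add_of_nonneg_left hN0)
    rw [Real.rpow_neg h0.le, inv_mul_le_iff₀ (by positivity)] at hle
    rw [lintegral_enorm_sq_eq_ofReal (hf.continuous_comp_sub hφ.1.continuous s)
      (hcrude.trans_lt ENNReal.ofReal_lt_top).ne]
    refine ENNReal.ofReal_le_ofReal ((pow_le_pow_left₀ (l2norm_nonneg _) hle 2).trans ?_)
    refine le_mul_of_one_le_left (by positivity) ?_
    linarith [C.coe_nonneg]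
  · refine hcrude.trans (ENNReal.ofReal_le_ofReal ?_)
    gcongr
    exact hN.trans (le_mul_of_one_le_left (hN0.trans hN) (Real.one_le_rpow h1.le hγ0.le))

/-- Averaging over times `r ∈ (0, |t|]`: the increment of `φ` between two points of a trajectory
is controlled by the mean increments from each of the two points. -/
lemma IsFlowOf.mul_enorm_sub_sq_le {a : Ec d → Ec d} {f : ℝ → Ec d → Ec d} {K : NNReal}
    (hf : IsFlowOf a f) (hK : LipschitzWith K a) {φ : Ec d → ℂ} (hφ : Continuous φ)
    {t τ M : ℝ} (hM : 0 ≤ M) (hτ : |τ| ≤ M * |t|) (x : Ec d) :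
    ENNReal.ofReal |t| * ‖φ (f τ x) - φ x‖ₑ ^ 2 ≤
      2 * ((∫⁻ s in Set.Icc (-((1 + M) * |t|)) ((1 + M) * |t|),
          ‖φ (f s (f τ x)) - φ (f τ x)‖ₑ ^ 2) +
        ∫⁻ s in Set.Icc (-((1 + M) * |t|)) ((1 + M) * |t|), ‖φ (f s x) - φ x‖ₑ ^ 2) := by
  set J := Set.Icc (-((1 + M) * |t|)) ((1 + M) * |t|) with hJ
  have hmeas : ∀ y, Measurable fun s => ‖φ (f s y) - φ y‖ₑ ^ 2 := fun y => by
    have : Continuous fun s => φ (f s y) - φ y :=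
      (hφ.comp (hf.continuous_uncurry.comp (by fun_prop : Continuous fun s : ℝ => (s, y)))).sub
        continuous_const
    exact this.enorm.measurable.pow_const 2
  have hshift : ∀ y σ, |σ| ≤ M * |t| →
      ∫⁻ r in Set.Ioc 0 |t|, ‖φ (f (r - σ) y) - φ y‖ₑ ^ 2 ≤
        ∫⁻ s in J, ‖φ (f s y) - φ y‖ₑ ^ 2 := fun y σ hσ => by
    rw [← lintegral_indicator measurableSet_Ioc, ← lintegral_indicator measurableSet_Icc,
      ← lintegral_sub_right_eq_self (J.indicator fun s => ‖φ (f s y) - φ y‖ₑ ^ 2) σ]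
    refine lintegral_mono fun r => ?_
    by_cases hr : r ∈ Set.Ioc 0 |t|
    · have : r - σ ∈ J := by
        obtain ⟨h1, h2⟩ := abs_le.1 hσ
        constructor <;> nlinarith [hr.1, hr.2]
      simp only [Set.indicator_of_mem hr, Set.indicator_of_mem this, le_refl]
    · simp [Set.indicator_of_notMem hr]
  calc ENNReal.ofReal |t| * ‖φ (f τ x) - φ x‖ₑ ^ 2
      = ∫⁻ _ in Set.Ioc 0 |t|, ‖φ (f τ x) - φ x‖ₑ ^ 2 := by
        rw [setLIntegral_const, Real.volume_Ioc, sub_zero, mul_comm]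
    _ ≤ ∫⁻ r in Set.Ioc 0 |t|, 2 * (‖φ (f (r - τ) (f τ x)) - φ (f τ x)‖ₑ ^ 2 +
          ‖φ (f (r - 0) x) - φ x‖ₑ ^ 2) := lintegral_mono fun r => by
        have := enorm_sub_sq_le (φ (f τ x)) (φ (f r x)) (φ x)
        rw [← enorm_neg (φ (f τ x) - φ (f r x)), neg_sub] at this
        rwa [← hf.apply_add hK, sub_add_cancel, sub_zero]
    _ = 2 * ((∫⁻ r in Set.Ioc 0 |t|, ‖φ (f (r - τ) (f τ x)) - φ (f τ x)‖ₑ ^ 2) +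
          ∫⁻ r in Set.Ioc 0 |t|, ‖φ (f (r - 0) x) - φ x‖ₑ ^ 2) := by
        rw [lintegral_const_mul' _ _ (by simp), lintegral_add_right]
        simpa using hmeas x
    _ ≤ _ := mul_le_mul_right
        (add_le_add (hshift _ τ hτ) (hshift _ 0 (by simpa using by positivity))) 2

/-- **Lemma 4.1 of ter Elst–Robinson, "Uniform subellipticity".**
Let `X` be a `C_b^∞`-vector field on `ℝ^d`, `ψ ∈ C_b^∞(ℝ^d;ℝ)` and `γ ∈ (0,1]`.  Then
`ψX` is again a `C_b^∞`-vector field, and there is a `c > 0` such that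
`‖φ‖_{2;ψX,γ} ≤ c ‖φ‖_{2;X,γ}` for all `φ ∈ C_c^∞(ℝ^d)`. -/
theorem holder_norm_mult_bound (d : ℕ) (a : Ec d → Ec d) (ψ : Ec d → ℝ)
    (ha : IsCbVF a) (hψ : IsCbR ψ) (γ : ℝ) (hγ0 : 0 < γ) (hγ1 : γ ≤ 1)
    (f g : ℝ → Ec d → Ec d)
    (hf : IsFlowOf a f) (hg : IsFlowOf (fun x => ψ x • a x) g) :
    IsCbVF (fun x => ψ x • a x) ∧
      ∃ c : ℝ, 0 < c ∧ ∀ φ : Ec d → ℂ, IsCc φ →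
        vfHolder g γ φ ≤ c * vfHolder f γ φ := by
  have hb := ha.smul hψ
  refine ⟨hb, ?_⟩
  obtain ⟨K, hK⟩ := exists_lipschitzWith_of_iteratedFDeriv_bound ha.1 (ha.2 1)
  obtain ⟨L, hL⟩ := exists_lipschitzWith_of_iteratedFDeriv_bound hψ.1 (hψ.2 1)
  obtain ⟨K', hK'⟩ := exists_lipschitzWith_of_iteratedFDeriv_bound hb.1 (hb.2 1)
  obtain ⟨Ma, hMa⟩ := exists_norm_le_of_iteratedFDeriv_bound (ha.2 0)
  obtain ⟨M, hM⟩ := exists_norm_le_of_iteratedFDeriv_bound (hψ.2 0)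
  obtain ⟨C, hC⟩ := hg.exists_lintegral_comp_le hK' 1
  obtain ⟨B, hB0, hB⟩ := hf.exists_lintegral_comp_sub_le hK hMa hγ0 hγ1 (1 + M)
  set D : ℝ := 4 * (C + 1) * (1 + M) * B * ((1 + M : ℝ) ^ γ) ^ 2 with hD
  have hD0 : 0 ≤ D := by positivity
  refine ⟨1 + √D, by positivity, fun φ hφ => ?_⟩
  have hφc := hφ.1.continuous
  set N := vfHolder f γ φ with hN
  have hN0 : 0 ≤ N := (l2norm_nonneg φ).trans (l2norm_le_vfHolder f γ φ)
  have hbound : ∀ t : ℝ, 0 < |t| → |t| ≤ 1 →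
      (l2norm fun x => φ (g t x) - φ x) ≤ √D * (|t| ^ γ * N) := by
    intro t ht0 ht1
    refine l2norm_le_of_lintegral_le (hg.continuous_comp_sub hφc t) (by positivity) ?_
    set R : ℝ := (1 + M) * |t| with hR
    have hR0 : 0 ≤ R := by positivity
    set H : Ec d → ENNReal := fun y => ∫⁻ s in Set.Icc (-R) R, ‖φ (f s y) - φ y‖ₑ ^ 2 with hH
    have hjoint : Measurable fun p : Ec d × ℝ => ‖φ (f p.2 p.1) - φ p.1‖ₑ ^ 2 := by
      have : Continuous fun p : Ec d × ℝ => φ (f p.2 p.1) - φ p.1 :=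
        (hφc.comp (hf.continuous_uncurry.comp continuous_swap)).sub (hφc.comp continuous_fst)
      exact this.enorm.measurable.pow_const 2
    have hHm : Measurable H := hjoint.lintegral_prod_right'
    have hHint : ∫⁻ y, H y ≤ ENNReal.ofReal (2 * R * (B * (R ^ γ * N) ^ 2)) := by
      rw [hH, lintegral_lintegral_swap hjoint.aemeasurable]
      calc ∫⁻ s in Set.Icc (-R) R, ∫⁻ y, ‖φ (f s y) - φ y‖ₑ ^ 2
          ≤ ∫⁻ _ in Set.Icc (-R) R, ENNReal.ofReal (B * (R ^ γ * N) ^ 2) := by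
            refine setLIntegral_mono measurable_const fun s hs => ?_
            have hs' : |s| ≤ R := abs_le.2 hs
            refine (hB φ hφ s (hs'.trans (mul_le_of_le_one_right (by positivity) ht1))).trans ?_
            gcongr
        _ = _ := by
            rw [setLIntegral_const, Real.volume_Icc, mul_comm,
              ← ENNReal.ofReal_mul (by linarith)]
            ring_nf
    have hmul : ENNReal.ofReal |t| * ∫⁻ x, ‖φ (g t x) - φ x‖ₑ ^ 2 ≤
        ENNReal.ofReal |t| * ENNReal.ofReal ((√D * (|t| ^ γ * N)) ^ 2) := by
      calc ENNReal.ofReal |t| * ∫⁻ x, ‖φ (g t x) - φ x‖ₑ ^ 2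
          = ∫⁻ x, ENNReal.ofReal |t| * ‖φ (g t x) - φ x‖ₑ ^ 2 :=
            (lintegral_const_mul' _ _ (by simp)).symm
        _ ≤ ∫⁻ x, 2 * (H (g t x) + H x) := lintegral_mono fun x => by
            obtain ⟨τ, hτ, hgx⟩ := hf.exists_smul_eq hMa hL hM hg hK' ht1 x
            rw [hgx]
            exact hf.mul_enorm_sub_sq_le hK hφc M.coe_nonneg hτ x
        _ = 2 * ((∫⁻ x, H (g t x)) + ∫⁻ x, H x) := by
            rw [lintegral_const_mul' _ _ (by simp), lintegral_add_right _ hHm]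
        _ ≤ 2 * (C * (∫⁻ x, H x) + ∫⁻ x, H x) := by
            gcongr
            exact hC t ht1 H hHm
        _ = 2 * (C + 1) * ∫⁻ x, H x := by ring
        _ ≤ 2 * (C + 1) * ENNReal.ofReal (2 * R * (B * (R ^ γ * N) ^ 2)) := by gcongr
        _ = ENNReal.ofReal (2 * (C + 1)) * ENNReal.ofReal (2 * R * (B * (R ^ γ * N) ^ 2)) := by
            rw [ENNReal.ofReal_mul zero_le_two, ENNReal.ofReal_add C.coe_nonneg zero_le_one]
            simp
        _ = _ := by
            rw [← ENNReal.ofReal_mul (by positivity), ← ENNReal.ofReal_mul (by positivity),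
              mul_pow (√D), Real.sq_sqrt hD0, hD, hR,
              Real.mul_rpow (by positivity) (by positivity)]
            ring_nf
    exact (ENNReal.mul_le_mul_iff_right (by simpa using ht0) (by simp)).1 hmul
  rw [vfHolder, add_mul, one_mul]
  refine add_le_add (l2norm_le_vfHolder f γ φ) (Real.sSup_le ?_ (by positivity))
  rintro _ ⟨t, ⟨ht0, ht1⟩, rfl⟩
  calc |t| ^ (-γ) * l2norm (fun x => φ (g t x) - φ x)
      ≤ |t| ^ (-γ) * (√D * (|t| ^ γ * N)) := by
        gcongr
        exact hbound t ht0 ht1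
    _ = (|t| ^ (-γ) * |t| ^ γ) * (√D * N) := by ring
    _ = √D * N := by rw [← Real.rpow_add ht0, neg_add_cancel, Real.rpow_zero, one_mul]

end
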